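/- arXiv:1802.07771 — 9 statements merged into one kernel-verified Lean document; each statement's English description precedes it below -/
import Mathlib

section
/- Let R be a rack, S ⊆ R, and let H be the subgroup of the permutation group of R generated by {f_s : s ∈ S}. Then the subrack generated by S equals HS = ⋃_{s ∈ S} {φ(s) : φ ∈ H}. -/
open Quandles

/-- A subrack of a rack `R`: a subset closed under the action and its inverse. -/
def IsSubrack {R : Type*} [Rack R] (Q : Set R) : Prop :=
  ∀ a ∈ Q, ∀ b ∈ Q, a ◃ b ∈ Q ∧ (Rack.act' a).symm b ∈ Q

/-- The subrack generated by a subset `S` of a rack: the intersection of all subracks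
containing `S`. -/
def subrackGen {R : Type*} [Rack R] (S : Set R) : Set R :=
  ⋂₀ {Q : Set R | IsSubrack Q ∧ S ⊆ Q}

/-- Every permutation in the group generated by the `f_s` conjugates `f_a` to `f_{φ a}`. -/
lemma act'_apply_of_mem_closure {R : Type*} [Rack R] {S : Set R} {φ : Equiv.Perm R}
    (hφ : φ ∈ Subgroup.closure ((Rack.act' : R → Equiv.Perm R) '' S)) (a : R) :
    (Rack.act' (φ a) : Equiv.Perm R) = φ * Rack.act' a * φ⁻¹ := by
  induction hφ using Subgroup.closure_induction generalizing a with
  | mem φ h =>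
    obtain ⟨s, -, rfl⟩ := h
    exact Rack.ad_conj s a
  | one => simp
  | mul φ ψ _ _ ihφ ihψ =>
    rw [Equiv.Perm.mul_apply, ihφ, ihψ]
    group
  | inv φ _ ih =>
    have h := ih (φ⁻¹ a)
    rw [← Equiv.Perm.mul_apply, mul_inv_cancel, Equiv.Perm.one_apply] at h
    rw [h]
    group

/-- The group generated by the `f_s` with `s ∈ S` preserves every subrack containing `S`. -/
lemma IsSubrack.apply_mem_of_mem_closure {R : Type*} [Rack R] {Q S : Set R} (hQ : IsSubrack Q)
    (hS : S ⊆ Q) {φ : Equiv.Perm R}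
    (hφ : φ ∈ Subgroup.closure ((Rack.act' : R → Equiv.Perm R) '' S)) {b : R} (hb : b ∈ Q) :
    φ b ∈ Q := by
  induction hφ using Subgroup.closure_induction'' generalizing b with
  | mem φ h =>
    obtain ⟨s, hs, rfl⟩ := h
    exact (hQ s (hS hs) b hb).1
  | inv_mem φ h =>
    obtain ⟨s, hs, rfl⟩ := h
    exact (hQ s (hS hs) b hb).2
  | one => exact hb
  | mul φ ψ _ _ ihφ ihψ => exact ihφ (ihψ hb)

/-- The union of the orbits of elements of `S` under the group generated by the `f_s` is a
subrack. -/
lemma isSubrack_iUnion_orbit {R : Type*} [Rack R] (S : Set R) :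
    IsSubrack (⋃ s ∈ S, {b : R |
      ∃ φ ∈ Subgroup.closure ((Rack.act' : R → Equiv.Perm R) '' S), φ s = b}) := by
  intro a ha b hb
  simp only [Set.mem_iUnion, Set.mem_ofPred_eq, exists_prop] at ha hb ⊢
  obtain ⟨s, hs, φ, hφ, rfl⟩ := ha
  obtain ⟨t, ht, ψ, hψ, rfl⟩ := hb
  have hact : (Rack.act' (φ s) : Equiv.Perm R) ∈
      Subgroup.closure ((Rack.act' : R → Equiv.Perm R) '' S) := by
    rw [act'_apply_of_mem_closure hφ]
    exact mul_mem (mul_mem hφ (Subgroup.subset_closure ⟨s, hs, rfl⟩)) (inv_mem hφ)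
  exact ⟨⟨t, ht, _, mul_mem hact hψ, rfl⟩, ⟨t, ht, _, mul_mem (inv_mem hact) hψ, rfl⟩⟩

/-- for `S ⊆ R` and `H` the subgroup of the permutation group of `R`
generated by `{f_s : s ∈ S}`, the subrack generated by `S` equals
`HS = ⋃ s ∈ S, {φ s : φ ∈ H}`. -/
theorem stmt_2 {R : Type*} [Rack R] (S : Set R) :
    subrackGen S =
      ⋃ s ∈ S, {b : R |
        ∃ φ ∈ Subgroup.closure ((Rack.act' : R → Equiv.Perm R) '' S), φ s = b} := by
  apply Set.Subset.antisymm
  · exact Set.sInter_subset_of_mem ⟨isSubrack_iUnion_orbit S, fun s hs =>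
      Set.mem_biUnion hs ⟨1, one_mem _, rfl⟩⟩
  · rintro b hb Q ⟨hQ, hS⟩
    simp only [Set.mem_iUnion, Set.mem_ofPred_eq, exists_prop] at hb
    obtain ⟨s, hs, φ, hφ, rfl⟩ := hb
    exact hQ.apply_mem_of_mem_closure hS hφ (hS hs)
end

section
/- Let R be a rack, a ∈ R, and let Q be a subrack of R such that Q ∩ ⟪a⟫ ≠ ∅. Then ⟪a⟫ ⊆ Q. -/
open Quandles

theorem act'_self_act {R : Type*} [Rack R] (c : R) : Rack.act' (c ◃ c) = Rack.act' c :=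
  Equiv.ext fun _ => Rack.self_act_act_eq

theorem act'_self_invAct {R : Type*} [Rack R] (c : R) : Rack.act' (c ◃⁻¹ c) = Rack.act' c :=
  Equiv.ext fun _ => Rack.self_invAct_act_eq

theorem IsSubrack.mem_of_self_act_mem {R : Type*} [Rack R] {Q : Set R} (hQ : IsSubrack Q) {c : R}
    (hc : c ◃ c ∈ Q) : c ∈ Q := by
  have h := (hQ _ hc _ hc).2
  rwa [act'_self_act, Rack.act'_symm_apply, Rack.invAct_act_eq] at h

theorem IsSubrack.mem_of_self_invAct_mem {R : Type*} [Rack R] {Q : Set R} (hQ : IsSubrack Q)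
    {c : R} (hc : c ◃⁻¹ c ∈ Q) : c ∈ Q := by
  have h := (hQ _ hc _ hc).1
  rwa [Rack.self_invAct_act_eq, Rack.act_invAct_eq] at h

/-- The elements acting as `a` does, and contained only in subracks that also contain `a`,
form a subrack. -/
theorem isSubrack_setOf_act'_eq {R : Type*} [Rack R] (a : R) :
    IsSubrack {b : R | Rack.act' b = Rack.act' a ∧ ∀ Q : Set R, IsSubrack Q → b ∈ Q → a ∈ Q} := by
  rintro b ⟨hb, -⟩ c ⟨hc, hca⟩
  have hbc : Rack.act' b = Rack.act' c := hb.trans hc.symm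
  rw [← Rack.act'_apply, hbc]
  exact ⟨⟨(act'_self_act c).trans hc, fun Q hQ h => hca Q hQ (hQ.mem_of_self_act_mem h)⟩,
    ⟨(act'_self_invAct c).trans hc, fun Q hQ h => hca Q hQ (hQ.mem_of_self_invAct_mem h)⟩⟩

/-- if a subrack `Q` meets `⟪a⟫`, then `⟪a⟫ ⊆ Q`. -/
theorem stmt_4 {R : Type*} [Rack R] (a : R) (Q : Set R) (hQ : IsSubrack Q)
    (h : (Q ∩ subrackGen {a}).Nonempty) : subrackGen {a} ⊆ Q := by
  obtain ⟨b, hbQ, hb⟩ := h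
  have hba := hb _ ⟨isSubrack_setOf_act'_eq a,
    Set.singleton_subset_iff.2 ⟨rfl, fun _ _ h => h⟩⟩
  exact Set.sInter_subset_of_mem ⟨hQ, Set.singleton_subset_iff.2 (hba.2 Q hQ hbQ)⟩
end

section
/- Let R be a rack and a, b, x, y ∈ R. If ⟪x⟫ = ⟪a⟫ and ⟪y⟫ = ⟪b⟫, then ⟪x◃y⟫ = ⟪a◃b⟫. (Hence the operation ⟪a⟫ * ⟪b⟫ := ⟪a◃b⟫ on the set of subracks generated by single elements is well defined.) -/
open Quandles

theorem mem_subrackGen_singleton_self {R : Type*} [Rack R] (a : R) : a ∈ subrackGen {a} :=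
  fun _ hQ => hQ.2 rfl

theorem subrackGen_singleton_subset {R : Type*} [Rack R] {Q : Set R} (hQ : IsSubrack Q) {a : R}
    (ha : a ∈ Q) : subrackGen {a} ⊆ Q :=
  Set.sInter_subset_of_mem ⟨hQ, Set.singleton_subset_iff.2 ha⟩

theorem isSubrack_subrackGen {R : Type*} [Rack R] (S : Set R) : IsSubrack (subrackGen S) :=
  fun a ha b hb =>
    ⟨fun Q hQ => (hQ.1 a (ha Q hQ) b (hb Q hQ)).1, fun Q hQ => (hQ.1 a (ha Q hQ) b (hb Q hQ)).2⟩

theorem act_invAct_distrib {R : Type*} [Rack R] (a z w : R) :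
    a ◃ (z ◃⁻¹ w) = (a ◃ z) ◃⁻¹ (a ◃ w) := by
  rw [← Rack.left_cancel (a ◃ z), ← Shelf.self_distrib, Rack.act_invAct_eq, Rack.act_invAct_eq]

theorem IsSubrack.preimage_act {R : Type*} [Rack R] {Q : Set R} (hQ : IsSubrack Q) (a : R) :
    IsSubrack {z | a ◃ z ∈ Q} := by
  intro z hz w hw
  have h := hQ _ hz _ hw
  rw [Rack.act'_symm_apply] at h ⊢
  rw [Set.mem_ofPred_eq, Set.mem_ofPred_eq, Shelf.self_distrib, act_invAct_distrib]
  exact h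

/-- The elements acting on `R` by a fixed permutation form a subrack. -/
theorem isSubrack_setOf_act'_eq_s5 {R : Type*} [Rack R] (f : Equiv.Perm R) :
    IsSubrack {z : R | Rack.act' z = f} := by
  intro z hz w hw
  rw [Set.mem_ofPred_eq] at hz hw
  refine ⟨?_, ?_⟩
  · rw [Set.mem_ofPred_eq, Rack.ad_conj, hz, hw, mul_inv_cancel_right]
  · have h := Rack.ad_conj z (z ◃⁻¹ w)
    rw [Rack.act_invAct_eq, hw, hz, eq_mul_inv_iff_mul_eq] at h
    exact (mul_left_cancel h).symm

theorem act_eq_of_mem_subrackGen_singleton {R : Type*} [Rack R] {a x : R}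
    (hx : x ∈ subrackGen {a}) (y : R) : x ◃ y = a ◃ y :=
  Equiv.congr_fun (subrackGen_singleton_subset (isSubrack_setOf_act'_eq_s5 (Rack.act' a)) rfl hx) y

theorem subrackGen_act_subset {R : Type*} [Rack R] (a : R) {b y : R}
    (hy : y ∈ subrackGen {b}) : subrackGen {a ◃ y} ⊆ subrackGen {a ◃ b} :=
  subrackGen_singleton_subset (isSubrack_subrackGen _)
    (subrackGen_singleton_subset ((isSubrack_subrackGen _).preimage_act a)
      (mem_subrackGen_singleton_self (a ◃ b)) hy)

/-- if `⟪x⟫ = ⟪a⟫` and `⟪y⟫ = ⟪b⟫` then `⟪x ◃ y⟫ = ⟪a ◃ b⟫`, so the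
operation `⟪a⟫ * ⟪b⟫ := ⟪a ◃ b⟫` is well defined. -/
theorem stmt_5 {R : Type*} [Rack R] (a b x y : R)
    (hx : subrackGen {x} = subrackGen {a}) (hy : subrackGen {y} = subrackGen {b}) :
    subrackGen {x ◃ y} = subrackGen {a ◃ b} := by
  rw [act_eq_of_mem_subrackGen_singleton (hx ▸ mem_subrackGen_singleton_self x) y]
  exact (subrackGen_act_subset a (hy ▸ mem_subrackGen_singleton_self y)).antisymm
    (subrackGen_act_subset a (hy ▸ mem_subrackGen_singleton_self b))
end

section
/- Let R be a rack, let ι : R → R be the map ι(a) = f_a⁻¹(a), and define a new binary operation on R by a ◃^ι b := a ◃ ι(b). Then (R, ◃^ι) is a quandle: ◃^ι is self-distributive (a ◃^ι (b ◃^ι c) = (a ◃^ι b) ◃^ι (a ◃^ι c)), for each a the map b ↦ a ◃^ι b is a bijection of R, and a ◃^ι a = a for all a ∈ R. -/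
open Quandles

/-- The map `ι : R → R`, `ι a = f_a⁻¹ a`. -/
def iota {R : Type*} [Rack R] (a : R) : R := (Rack.act' a).symm a

/-- The operation `a ◃^ι b := a ◃ ι b`. -/
def actIota {R : Type*} [Rack R] (a b : R) : R := a ◃ iota b

theorem act_iota_self {R : Type*} [Rack R] (a : R) : a ◃ iota a = a :=
  Rack.act_invAct_eq a a

theorem iota_act {R : Type*} [Rack R] (a b : R) : iota (a ◃ b) = a ◃ iota b := by
  rw [← Rack.left_cancel (a ◃ b), act_iota_self, ← Shelf.self_distrib, act_iota_self]

theorem iota_act_eq_act {R : Type*} [Rack R] (a b : R) : iota a ◃ b = a ◃ b :=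
  Rack.self_invAct_act_eq

theorem iota_bijective {R : Type*} [Rack R] : Function.Bijective (iota : R → R) :=
  (Rack.selfApplyEquiv R).symm.bijective

/-- `(R, ◃^ι)` is a quandle: `◃^ι` is self-distributive, each left
translation `b ↦ a ◃^ι b` is a bijection, and `a ◃^ι a = a` for all `a`. -/
theorem stmt_11 {R : Type*} [Rack R] :
    (∀ a b c : R, actIota a (actIota b c) = actIota (actIota a b) (actIota a c)) ∧
    (∀ a : R, Function.Bijective (fun b : R => actIota a b)) ∧
    (∀ a : R, actIota a a = a) := by
  refine ⟨fun a b c => ?_, fun a => (Rack.act' a).bijective.comp iota_bijective, act_iota_self⟩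
  simp only [actIota, iota_act]
  rw [← Shelf.self_distrib, iota_act_eq_act]
end

section
/- Let R be a rack, ι : R → R the map ι(a) = f_a⁻¹(a), and ◃^ι the operation a ◃^ι b := a ◃ ι(b). Then every subrack Q of (R, ◃) is also a subrack of the quandle (R, ◃^ι): for all a,b ∈ Q one has a ◃^ι b ∈ Q, and there exists c ∈ Q with a ◃^ι c = b. -/
open Quandles

/-- The map `a ↦ a ◃ a` is a right inverse of `ι`. -/
theorem iota_self_act {R : Type*} [Rack R] (a : R) : iota (a ◃ a) = a := by
  rw [iota, Rack.act'_symm_apply, Rack.self_act_invAct_eq, Rack.invAct_act_eq]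

/-- every subrack `Q` of `(R, ◃)` is also a subrack of the quandle
`(R, ◃^ι)`: `Q` is closed under `◃^ι` and for all `a b ∈ Q` there is `c ∈ Q` with
`a ◃^ι c = b`. -/
theorem stmt_12 {R : Type*} [Rack R] (Q : Set R) (hQ : IsSubrack Q) :
    ∀ a ∈ Q, ∀ b ∈ Q, actIota a b ∈ Q ∧ ∃ c ∈ Q, actIota a c = b := by
  intro a ha b hb
  have iota_mem : iota b ∈ Q := (hQ b hb b hb).2
  have hd := (hQ a ha b hb).2
  refine ⟨(hQ a ha _ iota_mem).1, _, (hQ _ hd _ hd).1, ?_⟩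
  rw [actIota, iota_self_act]
  exact Rack.act_invAct_eq a b
end

section
/- Let M be an (s,t)-rack and a ∈ M. Then for every natural number k, f_a^k(a) = (t^k + 1 − (1−s)^k) • a and (f_a⁻¹)^k(a) = ((1−s)^k · (t⁻¹)^k) • a. -/
/-- The left translation `f_a : b ↦ s • a + t • b` of the `(s,t)`-rack structure on an
`A`-module `M`, as a bijection of `M`; its inverse is `b ↦ t⁻¹ • (b - s • a)`. -/
def stAct {A M : Type*} [CommRing A] [AddCommGroup M] [Module A M]
    (s : A) (t : Aˣ) (a : M) : Equiv.Perm M where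
  toFun b := s • a + (t : A) • b
  invFun b := ((t⁻¹ : Aˣ) : A) • (b - s • a)
  left_inv b := by
    simp [add_sub_cancel_left, smul_smul]
  right_inv b := by
    simp [smul_sub, smul_smul]

theorem one_sub_pow_mul_of_sq_eq {A : Type*} [CommRing A] {s t : A}
    (hst : s ^ 2 = s * (1 - t)) (k : ℕ) :
    (1 - s) ^ k * (1 - s - t) = 1 - s - t := by
  induction k with
  | zero => simp
  | succ k ih => linear_combination (1 - s) * ih + hst

theorem mul_one_sub_pow_of_sq_eq {A : Type*} [CommRing A] {s t : A}
    (hst : s ^ 2 = s * (1 - t)) (k : ℕ) :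
    s * (1 - s) ^ k = s * t ^ k := by
  induction k with
  | zero => simp
  | succ k ih => linear_combination (1 - s) * ih - t ^ k * hst

/-- in an `(s,t)`-rack `M` (so `s² = s(1-t)` with `t` a unit), for every
`a ∈ M` and `k : ℕ` one has `f_a^k a = (t^k + 1 - (1-s)^k) • a` and
`(f_a⁻¹)^k a = ((1-s)^k · (t⁻¹)^k) • a`. -/
theorem stmt_16 {A M : Type*} [CommRing A] [AddCommGroup M] [Module A M]
    (s : A) (t : Aˣ) (hst : s ^ 2 = s * (1 - (t : A))) (a : M) (k : ℕ) :
    ((stAct s t a) ^ k) a = ((t : A) ^ k + 1 - (1 - s) ^ k) • a ∧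
    (((stAct s t a)⁻¹) ^ k) a = ((1 - s) ^ k * ((t⁻¹ : Aˣ) : A) ^ k) • a := by
  constructor
  · induction k with
    | zero => simp
    | succ k ih =>
      rw [pow_succ', Equiv.Perm.mul_apply, ih]
      change s • a + (t : A) • _ = _
      rw [smul_smul, ← add_smul]
      congr 1
      linear_combination one_sub_pow_mul_of_sq_eq hst k
  · induction k with
    | zero => simp
    | succ k ih =>
      rw [pow_succ', Equiv.Perm.mul_apply, ih]
      change ((t⁻¹ : Aˣ) : A) • (_ - s • a) = _
      rw [← sub_smul, smul_smul]
      congr 1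
      have hpow : (t : A) ^ k * ((t⁻¹ : Aˣ) : A) ^ k = 1 := by
        rw [← mul_pow, Units.mul_inv, one_pow]
      linear_combination ((t⁻¹ : Aˣ) : A) ^ (k + 1) * mul_one_sub_pow_of_sq_eq hst k
        + ((t⁻¹ : Aˣ) : A) * s * hpow
end

section
/- Let M be an (s,t)-rack and a ∈ M. Then ⟪a⟫ = {(t^k + 1 − (1−s)^k) • a : k ∈ ℕ} ∪ {((1−s)^k · (t⁻¹)^k) • a : k ∈ ℕ}. Moreover, if M is finite, then ⟪a⟫ = {(t^k + 1 − (1−s)^k) • a : k ∈ ℕ} = {((1−s)^k · (t⁻¹)^k) • a : k ∈ ℕ}. -/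
/-- A subrack of the `(s,t)`-rack `M`: a subset closed under the rack operation
`a ◃ b = s • a + t • b` and its inverse. -/
def IsStSubrack {A M : Type*} [CommRing A] [AddCommGroup M] [Module A M]
    (s : A) (t : Aˣ) (Q : Set M) : Prop :=
  ∀ a ∈ Q, ∀ b ∈ Q, stAct s t a b ∈ Q ∧ (stAct s t a).symm b ∈ Q

/-- The subrack of the `(s,t)`-rack `M` generated by a subset `S`: the intersection of
all subracks containing `S`. -/
def stGen {A M : Type*} [CommRing A] [AddCommGroup M] [Module A M]
    (s : A) (t : Aˣ) (S : Set M) : Set M :=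
  ⋂₀ {Q : Set M | IsStSubrack s t Q ∧ S ⊆ Q}

section StRack

variable {A M : Type*} [CommRing A] [AddCommGroup M] [Module A M] {s : A} {t : Aˣ}

theorem stAct_apply (s : A) (t : Aˣ) (a b : M) : stAct s t a b = s • a + (t : A) • b := rfl

theorem stAct_congr {a c : M} (h : s • c = s • a) : stAct s t c = stAct s t a := by
  ext b
  rw [stAct_apply, stAct_apply, h]

theorem smul_stAct (hst : s ^ 2 = s * (1 - (t : A))) {a b : M} :
    s • stAct s t a b = s • a ↔ s • b = s • a := by
  have h : s • stAct s t a b - s • a = (t : A) • (s • b - s • a) := by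
    rw [stAct_apply]
    linear_combination (norm := module) congrArg (· • a) hst
  rw [← sub_eq_zero, h, ← Units.smul_def, smul_eq_zero_iff_eq, sub_eq_zero]

theorem smul_stAct_zpow (hst : s ^ 2 = s * (1 - (t : A))) (a : M) (n : ℤ) :
    s • (stAct s t a ^ n) a = s • a := by
  induction n with
  | zero => simp
  | succ n ih => rwa [add_comm, zpow_one_add, Equiv.Perm.mul_apply, smul_stAct hst]
  | pred n ih =>
    rw [← smul_stAct hst, ← Equiv.Perm.mul_apply, ← zpow_one_add]
    simpa using ih

/-- The subrack generated by `a` is the orbit of `a` under its own left translation. -/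
theorem stGen_singleton (hst : s ^ 2 = s * (1 - (t : A))) (a : M) :
    stGen s t {a} = {x | ∃ n : ℤ, x = (stAct s t a ^ n) a} := by
  apply Set.Subset.antisymm
  · refine Set.sInter_subset_of_mem ⟨?_, Set.singleton_subset_iff.2 ⟨0, by simp⟩⟩
    rintro _ ⟨m, rfl⟩ _ ⟨n, rfl⟩
    rw [stAct_congr (smul_stAct_zpow hst a m)]
    refine ⟨⟨1 + n, ?_⟩, ⟨-1 + n, ?_⟩⟩
    · rw [zpow_one_add, Equiv.Perm.mul_apply]
    · rw [zpow_add, zpow_neg_one, Equiv.Perm.mul_apply, Equiv.Perm.inv_def]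
  · rintro _ ⟨n, rfl⟩ Q ⟨hQ, haQ⟩
    have ha : a ∈ Q := haQ rfl
    induction n with
    | zero => simpa using ha
    | succ n ih =>
      rw [add_comm, zpow_one_add, Equiv.Perm.mul_apply]
      exact (hQ a ha _ ih).1
    | pred n ih =>
      rw [sub_eq_neg_add, zpow_add, zpow_neg_one, Equiv.Perm.mul_apply, Equiv.Perm.inv_def]
      exact (hQ a ha _ ih).2

theorem stAct_pow_self (hst : s ^ 2 = s * (1 - (t : A))) (a : M) (k : ℕ) :
    (stAct s t a ^ k) a = ((t : A) ^ k + 1 - (1 - s) ^ k) • a := by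
  induction k with
  | zero => simp
  | succ k ih =>
    have h : (1 - s) ^ k * (s + t - 1) = s + t - 1 := by
      clear ih
      induction k with
      | zero => simp
      | succ k ih => linear_combination ih - (1 - s) ^ k * hst
    rw [pow_succ', Equiv.Perm.mul_apply, ih, stAct_apply, smul_smul, ← add_smul]
    congr 1
    linear_combination -h

theorem stAct_inv_pow_self (hst : s ^ 2 = s * (1 - (t : A))) (a : M) (k : ℕ) :
    ((stAct s t a)⁻¹ ^ k) a = ((1 - s) ^ k * ((t⁻¹ : Aˣ) : A) ^ k) • a := by
  induction k with
  | zero => simp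
  | succ k ih =>
    have ht : (t : A) * ((t⁻¹ : Aˣ) : A) = 1 := t.mul_inv
    have h : s * ((1 - s) ^ k * ((t⁻¹ : Aˣ) : A) ^ k) = s := by
      clear ih
      induction k with
      | zero => simp
      | succ k ih =>
        linear_combination ih + (1 - s) ^ k * ((t⁻¹ : Aˣ) : A) ^ k * (s * ht -
          ((t⁻¹ : Aˣ) : A) * hst)
    rw [pow_succ', Equiv.Perm.mul_apply, ih, Equiv.Perm.inv_eq_iff_eq, stAct_apply, smul_smul,
      ← add_smul]
    congr 1
    linear_combination h - (1 - s) ^ (k + 1) * ((t⁻¹ : Aˣ) : A) ^ k * ht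

end StRack

/-- in an `(s,t)`-rack `M`,
`⟪a⟫ = {(t^k + 1 - (1-s)^k) • a : k ∈ ℕ} ∪ {((1-s)^k (t⁻¹)^k) • a : k ∈ ℕ}`; if
moreover `M` is finite then `⟪a⟫` equals each of the two sets. -/
theorem stmt_17 {A M : Type*} [CommRing A] [AddCommGroup M] [Module A M]
    (s : A) (t : Aˣ) (hst : s ^ 2 = s * (1 - (t : A))) (a : M) :
    stGen s t {a} =
      {x : M | ∃ k : ℕ, x = ((t : A) ^ k + 1 - (1 - s) ^ k) • a} ∪
        {x : M | ∃ k : ℕ, x = ((1 - s) ^ k * ((t⁻¹ : Aˣ) : A) ^ k) • a} ∧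
    (Finite M →
      stGen s t {a} = {x : M | ∃ k : ℕ, x = ((t : A) ^ k + 1 - (1 - s) ^ k) • a} ∧
      {x : M | ∃ k : ℕ, x = ((t : A) ^ k + 1 - (1 - s) ^ k) • a} =
        {x : M | ∃ k : ℕ, x = ((1 - s) ^ k * ((t⁻¹ : Aˣ) : A) ^ k) • a}) := by
  simp only [← stAct_pow_self hst, ← stAct_inv_pow_self hst, stGen_singleton hst]
  refine ⟨?_, fun _ => ?_⟩
  · ext x
    constructor
    · rintro ⟨n, rfl⟩
      obtain ⟨k, rfl | rfl⟩ := n.eq_nat_or_neg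
      · exact Or.inl ⟨k, by rw [zpow_natCast]⟩
      · exact Or.inr ⟨k, by rw [zpow_neg, zpow_natCast, inv_pow]⟩
    · rintro (⟨k, rfl⟩ | ⟨k, rfl⟩)
      · exact ⟨k, by rw [zpow_natCast]⟩
      · exact ⟨-k, by rw [zpow_neg, zpow_natCast, inv_pow]⟩
  · have orbit_eq (g : Equiv.Perm M) :
        {x | ∃ n : ℤ, x = (g ^ n) a} = {x | ∃ k : ℕ, x = (g ^ k) a} := by
      ext x
      constructor
      · rintro ⟨n, rfl⟩
        obtain ⟨k, hk⟩ := (isOfFinOrder_of_finite g).mem_powers_iff_mem_zpowers.2 ⟨n, rfl⟩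
        exact ⟨k, congrArg (· a) hk.symm⟩
      · rintro ⟨k, rfl⟩
        exact ⟨k, by rw [zpow_natCast]⟩
    refine ⟨orbit_eq _, ?_⟩
    rw [← orbit_eq, ← orbit_eq]
    ext x
    exact (Equiv.neg ℤ).exists_congr fun n => by simp
end

section
/- Let n be a positive integer and let s, t ∈ ℤ/nℤ with t a unit and s² = s(1−t), making ℤ/nℤ an (s,t)-rack via a ◃ b = s·a + t·b. Then ⟪t·a⟫ = ⟪a⟫ for all a ∈ ℤ/nℤ (i.e. f_{0̄} = id in the corresponding quandle) if and only if s² = 0 in ℤ/nℤ and there exists a natural number k such that t^(k+1) = 1 − k·s in ℤ/nℤ. -/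
/-- `s` absorbs powers of `s + t`. -/
theorem mul_add_pow_eq_self {A : Type*} [CommRing A] {s t : A} (hst : s ^ 2 = s * (1 - t))
    (j : ℕ) : s * (s + t) ^ j = s := by
  induction j with
  | zero => simp
  | succ j ih =>
    rw [pow_succ, ← mul_assoc, ih]
    linear_combination hst

/-- `s + t` is invertible with inverse `t⁻¹ (1 - s)`. -/
theorem add_mul_inv_mul_one_sub {A : Type*} [CommRing A] {s : A} {t : Aˣ}
    (hst : s ^ 2 = s * (1 - (t : A))) :
    (s + t) * (((t⁻¹ : Aˣ) : A) * (1 - s)) = 1 := by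
  linear_combination (-((t⁻¹ : Aˣ) : A)) * hst + t.inv_mul

theorem mul_add_pow_eq {A : Type*} [CommRing A] {s t : A} (hs : s ^ 2 = 0) (h : s * t = s)
    (k : ℕ) : t * (s + t) ^ k = t ^ (k + 1) + k * s := by
  induction k with
  | zero => simp
  | succ k ih =>
    have hpow : s * t ^ (k + 1) = s := by
      clear ih
      induction k with
      | zero => simpa using h
      | succ k ih => rw [pow_succ, ← mul_assoc, ih, h]
    rw [pow_succ, ← mul_assoc, ih]
    push_cast
    linear_combination hpow + (k : A) * hs + (k : A) * h

namespace IsStSubrack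

variable {A : Type*} [CommRing A] {s : A} {t : Aˣ} {Q : Set A}

theorem add_pow_mul_mem (hQ : IsStSubrack s t Q) {x : A} (hx : x ∈ Q) (k : ℕ) :
    (s + t) ^ k * x ∈ Q := by
  induction k with
  | zero => simpa using hx
  | succ k ih =>
    convert (hQ _ ih _ ih).1 using 1
    simp only [stAct, Equiv.coe_fn_mk, smul_eq_mul]
    ring

theorem inv_pow_mul_mem (hQ : IsStSubrack s t Q) {x : A} (hx : x ∈ Q) (k : ℕ) :
    (((t⁻¹ : Aˣ) : A) * (1 - s)) ^ k * x ∈ Q := by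
  induction k with
  | zero => simpa using hx
  | succ k ih =>
    convert (hQ _ ih _ ih).2 using 1
    simp only [stAct, Equiv.coe_fn_symm_mk, smul_eq_mul]
    ring

end IsStSubrack

/-- In a finite ring, the multiples of `x` by powers of `s + t` form a subrack. -/
theorem isStSubrack_range_add_pow_mul {A : Type*} [CommRing A] [Finite A] {s : A} {t : Aˣ}
    (hst : s ^ 2 = s * (1 - (t : A))) (x : A) :
    IsStSubrack s t (Set.range fun j : ℕ => (s + t) ^ j * x) := by
  obtain ⟨N, hN, hpow⟩ := IsOfFinOrder.exists_pow_eq_one <|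
    isOfFinOrder_of_finite (Units.mkOfMulEqOne _ _ (add_mul_inv_mul_one_sub hst))
  have hc : (s + t : A) ^ N = 1 := by simpa using congrArg Units.val hpow
  obtain ⟨M, rfl⟩ := Nat.exists_eq_add_of_lt hN
  simp only [zero_add] at hc
  rintro _ ⟨i, rfl⟩ _ ⟨j, rfl⟩
  have hi := mul_add_pow_eq_self hst i
  have hj := mul_add_pow_eq_self hst j
  refine ⟨⟨j + 1, ?_⟩, ⟨M + j, ?_⟩⟩
  · simp only [stAct, Equiv.coe_fn_mk, smul_eq_mul]
    linear_combination x * hj - x * hi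
  · rw [Equiv.eq_symm_apply]
    simp only [stAct, Equiv.coe_fn_mk, smul_eq_mul]
    have hMj := mul_add_pow_eq_self hst (M + j)
    linear_combination x * hi - x * hMj + (s + t) ^ j * x * hc

/-- for `ℤ/nℤ` (`n > 0`) as an `(s,t)`-rack (`t` a unit,
`s² = s(1-t)`, `a ◃ b = s·a + t·b`), one has `⟪t·a⟫ = ⟪a⟫` for all `a` (i.e.
`f_{0̄} = id` in the corresponding quandle) iff `s² = 0` and `t^(k+1) = 1 - k·s`
for some natural number `k`. -/
theorem stmt_18 (n : ℕ) (hn : 0 < n) (s : ZMod n) (t : (ZMod n)ˣ)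
    (hst : s ^ 2 = s * (1 - (t : ZMod n))) :
    (∀ a : ZMod n, stGen s t {(t : ZMod n) * a} = stGen s t {a}) ↔
      (s ^ 2 = 0 ∧ ∃ k : ℕ, (t : ZMod n) ^ (k + 1) = 1 - (k : ZMod n) * s) := by
  have : NeZero n := ⟨hn.ne'⟩
  constructor
  · intro h
    have h1 : (1 : ZMod n) ∈ stGen s t {(t : ZMod n) * 1} := by
      rw [h 1]
      exact fun Q hQ => hQ.2 rfl
    obtain ⟨k, hk⟩ := h1 _ ⟨isStSubrack_range_add_pow_mul hst (t : ZMod n),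
      Set.singleton_subset_iff.2 ⟨0, by simp⟩⟩
    simp only at hk
    have hs : s * t = s := by
      linear_combination s * hk - (t : ZMod n) * mul_add_pow_eq_self hst k
    have hs2 : s ^ 2 = 0 := by linear_combination hst - hs
    exact ⟨hs2, k, by linear_combination hk - mul_add_pow_eq hs2 hs k⟩
  · rintro ⟨hs2, k, hk⟩ a
    have hs : s * t = s := by linear_combination hst - hs2
    have htc : (s + t) ^ k * (t : ZMod n) = 1 := by
      linear_combination mul_add_pow_eq hs2 hs k + hk
    have hdt : (((t⁻¹ : (ZMod n)ˣ) : ZMod n) * (1 - s)) ^ k = t := by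
      have hcd := congrArg (· ^ k) (add_mul_inv_mul_one_sub hst)
      simp only [mul_pow (s + (t : ZMod n)), one_pow] at hcd
      linear_combination (t : ZMod n) * hcd -
        (((t⁻¹ : (ZMod n)ˣ) : ZMod n) * (1 - s)) ^ k * htc
    unfold stGen
    congr 1
    ext Q
    simp only [Set.mem_ofPred_eq, Set.singleton_subset_iff]
    refine and_congr_right fun hQ => ⟨fun hx => ?_, fun hx => ?_⟩
    · simpa [← mul_assoc, htc] using hQ.add_pow_mul_mem hx k
    · simpa only [hdt] using hQ.inv_pow_mul_mem hx k
end

section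
/- Let n be a positive integer and let s, t ∈ ℤ/nℤ with t a unit and s² = s(1−t), making ℤ/nℤ an (s,t)-rack via x ◃ y = s·x + t·y. Then for all x, y ∈ ℤ/nℤ, ⟪s·x + t·y⟫ = ⟪s·x + (1−s)·y⟫; that is, in the corresponding quandle, ⟪x⟫ * ⟪y⟫ = ⟪s·x + (1−s)·y⟫. -/
/-- The subrack generated by `a` is also generated by `a ◃ a`. -/
theorem stGen_singleton_stAct_self {A M : Type*} [CommRing A] [AddCommGroup M] [Module A M]
    {s : A} {t : Aˣ} (hst : s ^ 2 = s * (1 - (t : A))) (a : M) :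
    stGen s t {stAct s t a a} = stGen s t {a} := by
  have hact : stAct s t (stAct s t a a) a = stAct s t a a := by
    simp only [stAct, Equiv.coe_fn_mk, ← add_smul, smul_smul]
    congr 1
    linear_combination hst
  unfold stGen
  congr 1
  ext Q
  simp only [Set.mem_ofPred_eq, Set.singleton_subset_iff]
  refine and_congr_right fun hQ => ⟨fun h => ?_, fun h => (hQ a h a h).1⟩
  have hmem := (hQ _ h _ h).2
  rwa [(Equiv.symm_apply_eq _).2 hact.symm] at hmem

/-- for `ℤ/nℤ` (`n > 0`) as an `(s,t)`-rack (`t` a unit,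
`s² = s(1-t)`, `x ◃ y = s·x + t·y`), for all `x y` one has
`⟪s·x + t·y⟫ = ⟪s·x + (1-s)·y⟫`, i.e. in the corresponding quandle
`⟪x⟫ * ⟪y⟫ = ⟪s·x + (1-s)·y⟫`. -/
theorem stmt_19 (n : ℕ) (hn : 0 < n) (s : ZMod n) (t : (ZMod n)ˣ)
    (hst : s ^ 2 = s * (1 - (t : ZMod n))) (x y : ZMod n) :
    stGen s t {s * x + (t : ZMod n) * y} = stGen s t {s * x + (1 - s) * y} := by
  rw [← stGen_singleton_stAct_self hst (s * x + (1 - s) * y)]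
  congr 2
  simp only [stAct, Equiv.coe_fn_mk, smul_eq_mul]
  linear_combination (y - x) * hst
end
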